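/- arXiv:2210.09954 — 8 statements merged into one kernel-verified Lean document; each statement's English description precedes it below -/
import Mathlib

section
/- Let λ > 0, M > 0 and n ≥ 1. Suppose f : ℂ → ℂ is 2π-periodic (f(z + 2π) = f(z) for all z ∈ ℂ), is differentiable on the open strip {z ∈ ℂ : |Im z| < λ}, and satisfies ‖f(z)‖ ≤ M for all z in this strip. Let I = ∫₀^{2π} f(x) dx (integral over the real segment [0, 2π]) and let I_n = (2π/n) · ∑_{j=1}^{n} f(2πj/n) be the n-point trapezoidal approximation. Then ‖I − I_n‖ ≤ 4πM / (exp(λn) − 1). -/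
open Real Complex

/-- The integral of a `T`-periodic function holomorphic on a horizontal strip, taken over one
period, does not change when the path is translated vertically within the strip. -/
theorem intervalIntegral_eq_shift_of_periodic {h : ℂ → ℂ} {lam T s : ℝ}
    (hper : ∀ z : ℂ, h (z + T) = h z)
    (hdiff : DifferentiableOn ℂ h {z : ℂ | |z.im| < lam}) (hs : |s| < lam) :
    ∫ x : ℝ in 0..T, h x = ∫ x : ℝ in 0..T, h (x + s * I) := by
  have key := Complex.integral_boundary_rect_eq_zero_of_differentiableOn h 0 (T + s * I)
    (hdiff.mono fun z hz ↦ by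
      have h2 := hz.2
      simp only [Set.mem_preimage, zero_im, add_im, ofReal_im, mul_im, I_im, I_re, ofReal_re,
        mul_one, mul_zero, add_zero, zero_add] at h2
      have := Set.abs_sub_left_of_mem_uIcc h2
      simp only [sub_zero] at this
      exact this.trans_lt hs)
  have hvert : ∀ y : ℝ, h (T + y * I) = h (y * I) := fun y ↦ by rw [add_comm, hper]
  simp [hvert] at key
  exact sub_eq_zero.mp key

theorem continuous_ofReal_of_differentiableOn_strip {g : ℂ → ℂ} {lam : ℝ} (hlam : 0 < lam)
    (hdiff : DifferentiableOn ℂ g {z : ℂ | |z.im| < lam}) : Continuous fun x : ℝ ↦ g x :=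
  hdiff.continuousOn.comp_continuous continuous_ofReal fun x ↦ by simpa using hlam

/-- The Fourier coefficients of a `T`-periodic function holomorphic and bounded on the strip
`|Im z| < lam` decay geometrically. -/
theorem norm_integral_exp_mul_le_of_strip {g : ℂ → ℂ} {lam M T : ℝ} (hlam : 0 < lam) (hT : 0 < T)
    (hper : ∀ z : ℂ, g (z + T) = g z)
    (hdiff : DifferentiableOn ℂ g {z : ℂ | |z.im| < lam})
    (hbound : ∀ z : ℂ, |z.im| < lam → ‖g z‖ ≤ M) (k : ℤ) :
    ‖∫ x : ℝ in 0..T, Complex.exp (-(2 * Real.pi * I * k * x / T)) * g x‖ ≤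
      M * Real.exp (-(2 * Real.pi * lam / T)) ^ k.natAbs * T := by
  have hT' : (T : ℂ) ≠ 0 := by exact_mod_cast hT.ne'
  have hshift : ∀ s ∈ Set.Ico 0 lam,
      ‖∫ x : ℝ in 0..T, Complex.exp (-(2 * Real.pi * I * k * x / T)) * g x‖ ≤
        M * Real.exp (-(2 * Real.pi * s / T)) ^ k.natAbs * T := by
    rintro s ⟨hs0, hs⟩
    obtain ⟨t, ht, hkt⟩ : ∃ t : ℝ, |t| < lam ∧ k * t = -(k.natAbs * s) := by
      rcases le_total 0 k with hk | hk
      · refine ⟨-s, by rwa [abs_neg, abs_of_nonneg hs0], ?_⟩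
        rw [Nat.cast_natAbs, abs_of_nonneg hk]; ring
      · refine ⟨s, by rwa [abs_of_nonneg hs0], ?_⟩
        rw [Nat.cast_natAbs, abs_of_nonpos hk]; push_cast; ring
    have hexp : ∀ z : ℂ, Complex.exp (-(2 * Real.pi * I * k * (z + T) / T)) =
        Complex.exp (-(2 * Real.pi * I * k * z / T)) := fun z ↦ by
      rw [Complex.exp_eq_exp_iff_exists_int]
      exact ⟨-k, by push_cast; field_simp; ring⟩
    rw [intervalIntegral_eq_shift_of_periodic (s := t) (lam := lam)
      (h := fun z ↦ Complex.exp (-(2 * Real.pi * I * k * z / T)) * g z)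
      (fun z ↦ by simp only [hexp, hper]) (.mul (by fun_prop) hdiff) ht]
    refine (intervalIntegral.norm_integral_le_of_norm_le_const fun x _ ↦ ?_).trans_eq
      (by rw [sub_zero, abs_of_pos hT])
    rw [norm_mul, Complex.norm_exp, mul_comm M, ← Real.exp_nat_mul]
    have hre : (-(2 * Real.pi * I * k * (x + t * I) / T) : ℂ).re =
        k.natAbs * -(2 * Real.pi * s / T) := by
      have : (-(2 * Real.pi * I * k * (x + t * I) / T) : ℂ) =
          ((2 * Real.pi * (k * t) / T : ℝ) : ℂ) + ((-(2 * Real.pi * k * x / T) : ℝ) : ℂ) * I := by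
        push_cast
        field_simp
        linear_combination (-(k * t : ℂ)) * I_sq
      rw [this, hkt]
      simp
      ring
    rw [hre]
    gcongr
    exact hbound _ (by simpa using ht)
  have hcont : Continuous fun s : ℝ ↦ M * Real.exp (-(2 * Real.pi * s / T)) ^ k.natAbs * T := by
    fun_prop
  have : (nhdsWithin lam (Set.Ico 0 lam)).NeBot := by
    rw [← mem_closure_iff_nhdsWithin_neBot, closure_Ico hlam.ne]
    exact Set.right_mem_Icc.2 hlam.le
  exact ge_of_tendsto (hcont.tendsto lam |>.mono_left nhdsWithin_le_nhds)
    (Filter.mem_of_superset self_mem_nhdsWithin hshift)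

/-- A `T`-periodic function holomorphic and bounded on a strip is exponentially close, at a real
point, to its mean over one period. -/
theorem norm_sub_average_le_of_strip {g : ℂ → ℂ} {lam M T : ℝ} (hlam : 0 < lam) (hT : 0 < T)
    (hper : ∀ z : ℂ, g (z + T) = g z)
    (hdiff : DifferentiableOn ℂ g {z : ℂ | |z.im| < lam})
    (hbound : ∀ z : ℂ, |z.im| < lam → ‖g z‖ ≤ M) :
    ‖g 0 - (∫ x : ℝ in 0..T, g x) / T‖ ≤ 2 * M / (Real.exp (2 * Real.pi * lam / T) - 1) := by
  have : Fact (0 < T) := ⟨hT⟩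
  have hperR : Function.Periodic (fun x : ℝ ↦ g x) T := fun x ↦ by simp [hper]
  let G : C(AddCircle T, ℂ) := ⟨hperR.lift, continuous_coinduced_dom.mpr
    (continuous_ofReal_of_differentiableOn_strip hlam hdiff)⟩
  have hG : ∀ x : ℝ, G x = g x := fun x ↦ rfl
  set c : ℤ → ℂ := fourierCoeff G
  have hc : ∀ k, c k =
      (∫ x : ℝ in 0..T, Complex.exp (-(2 * Real.pi * I * k * x / T)) * g x) / T := by
    intro k
    rw [show c k = _ from fourierCoeff_eq_intervalIntegral G k 0, zero_add]
    simp only [fourier_coe_apply, hG, smul_eq_mul, Complex.real_smul]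
    push_cast
    simp only [mul_neg, neg_mul, neg_div, one_div, ← div_eq_inv_mul]
  have hexponent : 0 < 2 * Real.pi * lam / T := by
    have := Real.pi_pos
    positivity
  set r := Real.exp (-(2 * Real.pi * lam / T)) with hr
  have hr0 : 0 < r := Real.exp_pos _
  have hr1 : r < 1 := Real.exp_lt_one_iff.mpr (neg_neg_of_pos hexponent)
  have hcr : ∀ k, ‖c k‖ ≤ M * r ^ k.natAbs := fun k ↦ by
    rw [hc, norm_div, norm_real, Real.norm_of_nonneg hT.le, div_le_iff₀ hT]
    exact norm_integral_exp_mul_le_of_strip hlam hT hper hdiff hbound k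
  have hgeom := (hasSum_geometric_of_lt_one hr0.le hr1).mul_left M
  have hsummable : Summable c := by
    refine Summable.of_norm_bounded (g := fun k : ℤ ↦ M * r ^ k.natAbs) ?_ hcr
    rw [summable_int_iff_summable_nat_and_neg]
    simpa using hgeom.summable
  have hsum := has_pointwise_sum_fourier_series_of_summable hsummable (0 : ℝ)
  simp only [fourier_coe_apply, hG, ofReal_zero, mul_zero, zero_div, Complex.exp_zero,
    smul_eq_mul, mul_one] at hsum
  have htail := (hasSum_nat_add_iff' 1).mpr hsum.nat_add_neg
  have hc0 : c 0 = (∫ x : ℝ in 0..T, g x) / T := by simp [hc]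
  have hle := htail.norm_le_of_bounded (hgeom.mul_left (2 * r)) fun k ↦ by
    refine (norm_add_le _ _).trans ((add_le_add (hcr _) (hcr _)).trans_eq ?_)
    rw [Int.natAbs_neg, Int.natAbs_natCast]
    ring
  rw [← hc0]
  convert! hle using 1
  · congr 1
    simp
    ring
  · have := Real.one_lt_exp_iff.mpr hexponent
    have : Real.exp (2 * Real.pi * lam / T) - 1 ≠ 0 := by linarith
    rw [hr, Real.exp_neg]
    field_simp

/-- Geometric convergence of the trapezoid rule for a 2π-periodic function
analytic and bounded by `M` on the strip `|Im z| < lam`. -/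
theorem trapezoid_rule_geometric_convergence
    (lam M : ℝ) (n : ℕ) (hlam : 0 < lam) (hM : 0 < M) (hn : 1 ≤ n)
    (f : ℂ → ℂ)
    (hper : ∀ z : ℂ, f (z + 2 * Real.pi) = f z)
    (hdiff : DifferentiableOn ℂ f {z : ℂ | |z.im| < lam})
    (hbound : ∀ z : ℂ, |z.im| < lam → ‖f z‖ ≤ M) :
    ‖(∫ x : ℝ in (0:ℝ)..(2 * Real.pi), f x) -
        (2 * Real.pi / n) * ∑ j ∈ Finset.Icc 1 n, f (2 * Real.pi * j / n)‖ ≤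
      4 * Real.pi * M / (Real.exp (lam * n) - 1) := by
  have hpi := Real.pi_pos
  have hn0 : (0 : ℝ) < n := by exact_mod_cast hn
  have hnC : (n : ℂ) ≠ 0 := by exact_mod_cast hn0.ne'
  obtain ⟨T, hT⟩ : ∃ T : ℝ, T = 2 * Real.pi / n := ⟨_, rfl⟩
  have hT0 : 0 < T := by rw [hT]; positivity
  have hnT : n * T = 2 * Real.pi := by rw [hT]; field_simp
  have hnTC : (n * T : ℂ) = 2 * Real.pi := by exact_mod_cast hnT
  let g : ℂ → ℂ := fun z ↦ (∑ j ∈ Finset.range n, f (z + (j * T : ℝ))) / n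
  have him : ∀ (z : ℂ) (y : ℝ), |z.im| < lam → |(z + y).im| < lam := by simp
  have hgshift : ∀ z, g (z + T) = (∑ j ∈ Finset.range n, f (z + ((j + 1 : ℕ) * T : ℝ))) / n := by
    intro z
    simp only [g]
    congr! 3
    push_cast
    ring
  have hgper : ∀ z, g (z + T) = g z := by
    intro z
    have h1 := Finset.sum_range_succ (fun j : ℕ ↦ f (z + (j * T : ℝ))) n
    have h2 := Finset.sum_range_succ' (fun j : ℕ ↦ f (z + (j * T : ℝ))) n
    have h3 : f (z + (n * T : ℝ)) = f (z + ((0 : ℕ) * T : ℝ)) := by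
      rw [hnT]; simp [hper]
    rw [hgshift]
    simp only [g]
    congr 1
    rw [h3] at h1
    exact add_right_cancel (h2.symm.trans h1)
  have hgdiff : DifferentiableOn ℂ g {z : ℂ | |z.im| < lam} :=
    (DifferentiableOn.fun_sum fun j _ ↦
      hdiff.comp (by fun_prop) fun z hz ↦ him z _ hz).div_const _
  have hgbound : ∀ z : ℂ, |z.im| < lam → ‖g z‖ ≤ M := fun z hz ↦ by
    rw [norm_div, Complex.norm_natCast, div_le_iff₀ hn0]
    refine (norm_sum_le_of_le _ fun j _ ↦ hbound _ (him z _ hz)).trans_eq ?_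
    simp [mul_comm]
  have hsum : ∑ j ∈ Finset.Icc 1 n, f (2 * Real.pi * j / n) = n * g 0 := by
    rw [← hgper 0, hgshift, mul_div_cancel₀ _ hnC, Finset.range_eq_Ico,
      Finset.sum_Ico_add' (fun j : ℕ ↦ f (0 + (j * T : ℝ))) 0 n 1, zero_add,
      Finset.Ico_add_one_right_eq_Icc]
    refine Finset.sum_congr rfl fun j _ ↦ ?_
    rw [hT]
    congr 1
    push_cast
    ring
  have hcont := continuous_ofReal_of_differentiableOn_strip hlam hdiff
  have hint : ∫ x : ℝ in 0..T, g x = (∫ x : ℝ in 0..2 * Real.pi, f x) / n := by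
    have hadj := intervalIntegral.sum_integral_adjacent_intervals (μ := MeasureTheory.volume)
      (f := fun x : ℝ ↦ f x) (a := fun j : ℕ ↦ j * T) (n := n)
      fun _ _ ↦ hcont.intervalIntegrable _ _
    rw [Nat.cast_zero, zero_mul, hnT] at hadj
    rw [← hadj, intervalIntegral.integral_div, intervalIntegral.integral_finsetSum]
    · congr 1
      refine Finset.sum_congr rfl fun j _ ↦ ?_
      have := intervalIntegral.integral_comp_add_right (a := 0) (b := T) (fun x : ℝ ↦ f x) (j * T)
      simp only [ofReal_add] at this
      rw [this]
      congr 1 <;> push_cast <;> ring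
    · intro j _
      have := hcont.comp (continuous_add_const (j * T : ℝ))
      exact Continuous.intervalIntegrable (by simpa [Function.comp_def] using this) _ _
  have key := norm_sub_average_le_of_strip hlam hT0 hgper hgdiff hgbound
  have hexp : 2 * Real.pi * lam / T = lam * n := by rw [hT]; field_simp
  rw [hexp, hint, div_div, hnTC] at key
  calc _ = ‖-(2 * Real.pi : ℝ) * (g 0 - (∫ x : ℝ in 0..2 * Real.pi, f x) / (2 * Real.pi))‖ := by
        rw [hsum]
        congr 1
        push_cast
        field_simp
        ring
    _ ≤ 2 * Real.pi * (2 * M / (Real.exp (lam * n) - 1)) := by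
        rw [norm_mul, norm_neg, norm_real, Real.norm_of_nonneg (by positivity)]
        gcongr
    _ = _ := by ring
end

section
/- Let 0 < a < 1 and let t ∈ (−π, π) be real. Define g : ℝ → ℂ by g(t) = −i · Log((e^{it} + a)/(1 + a·e^{it})), where Log is the principal branch of the complex logarithm. Then g(t) is real, and g has derivative at t equal to (1 − a²)/(a² + 2a·cos(t) + 1). -/
open Real Complex

/-- The map `z ↦ (z + a) / (1 + a z)` with real `a` preserves the unit circle. -/
theorem norm_add_ofReal_eq_norm_one_add_mul (a : ℝ) {z : ℂ} (hz : ‖z‖ = 1) :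
    ‖z + a‖ = ‖1 + a * z‖ := by
  have h : z.re * z.re + z.im * z.im = 1 := by
    rw [← Complex.normSq_apply, Complex.normSq_eq_norm_sq, hz, one_pow]
  rw [← sq_eq_sq₀ (norm_nonneg _) (norm_nonneg _), ← Complex.normSq_eq_norm_sq,
    ← Complex.normSq_eq_norm_sq, Complex.normSq_apply, Complex.normSq_apply]
  simp only [Complex.add_re, Complex.add_im, Complex.ofReal_re, Complex.ofReal_im, Complex.one_re,
    Complex.one_im, Complex.mul_re, Complex.mul_im]
  linear_combination (1 - a ^ 2) * h

/-- The only point of the unit circle outside the slit plane is `-1`. -/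
theorem mem_slitPlane_of_norm_eq_one {w : ℂ} (hw : ‖w‖ = 1) (hne : w ≠ -1) :
    w ∈ Complex.slitPlane := by
  rw [Complex.mem_slitPlane_iff]
  by_contra! h
  obtain ⟨hre, him⟩ := h
  have h1 : w.re * w.re + w.im * w.im = 1 := by
    rw [← Complex.normSq_apply, Complex.normSq_eq_norm_sq, hw, one_pow]
  rw [him] at h1
  refine hne (Complex.ext ?_ (by simpa using him))
  simp only [Complex.neg_re, Complex.one_re]
  nlinarith

/-- The exponential `e^{it}` avoids `-1` for `t ∈ (-π, π)`. -/
theorem exp_I_mul_ne_neg_one {t : ℝ} (ht : t ∈ Set.Ioo (-Real.pi) Real.pi) :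
    Complex.exp (Complex.I * t) ≠ -1 := by
  intro h
  have harg := Complex.arg_exp_mul_I t
  rw [mul_comm, h, Complex.arg_neg_one,
    (toIocMod_eq_self Real.two_pi_pos).2 ⟨ht.1, by linarith [ht.2]⟩] at harg
  linarith [ht.2]

/-- The boundary correspondence map
`g(t) = −i·Log((e^{it} + a)/(1 + a·e^{it}))` is real-valued on `(−π, π)`
and has derivative `(1 − a²)/(a² + 2a·cos t + 1)` there. -/
theorem boundary_correspondence_deriv
    (a : ℝ) (ha0 : 0 < a) (ha1 : a < 1)
    (t : ℝ) (ht : t ∈ Set.Ioo (-Real.pi) Real.pi)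
    (g : ℝ → ℂ)
    (hg : ∀ s : ℝ, g s = -Complex.I *
      Complex.log ((Complex.exp (Complex.I * s) + a) /
        (1 + a * Complex.exp (Complex.I * s)))) :
    (g t).im = 0 ∧
    HasDerivAt g
      (((1 - a ^ 2) / (a ^ 2 + 2 * a * Real.cos t + 1) : ℝ) : ℂ) t := by
  have hexp : ‖Complex.exp (Complex.I * t)‖ = 1 := by
    rw [mul_comm]; exact Complex.norm_exp_ofReal_mul_I t
  have hcos : 2 * (Real.cos t : ℂ) * Complex.exp (Complex.I * t)
      = Complex.exp (Complex.I * t) ^ 2 + 1 := by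
    rw [mul_comm Complex.I, Complex.exp_mul_I, Complex.ofReal_cos]
    linear_combination Complex.sin_sq_add_cos_sq (t : ℂ) - Complex.sin t ^ 2 * Complex.I_sq
  have hder : HasDerivAt (fun s : ℝ => Complex.exp (Complex.I * s))
      (Complex.exp (Complex.I * t) * Complex.I) t := by
    simpa using ((Complex.ofRealCLM.hasDerivAt (x := t)).const_mul Complex.I).cexp
  have hne := exp_I_mul_ne_neg_one ht
  have hgt := hg t
  obtain rfl : g = _ := funext hg
  have hz0 : Complex.exp (Complex.I * t) ≠ 0 := Complex.exp_ne_zero _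
  generalize hz : Complex.exp (Complex.I * t) = z at *
  have hnorm := norm_add_ofReal_eq_norm_one_add_mul a hexp
  have hden : 1 + a * z ≠ 0 := by
    intro h
    have h1 : ‖(a : ℂ) * z‖ = 1 := by
      rw [show (a : ℂ) * z = -1 by linear_combination h, norm_neg, norm_one]
    rw [norm_mul, hexp, Complex.norm_real, Real.norm_of_nonneg ha0.le] at h1
    linarith
  have hnum : z + a ≠ 0 := by
    rwa [← norm_ne_zero_iff, hnorm, norm_ne_zero_iff]
  have hw : ‖(z + a) / (1 + a * z)‖ = 1 := by
    rw [norm_div, hnorm, div_self (norm_ne_zero_iff.2 hden)]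
  have ha : (1 + a : ℂ) ≠ 0 := by
    exact_mod_cast (by linarith : (1 + a : ℝ) ≠ 0)
  have hslit : (z + a) / (1 + a * z) ∈ Complex.slitPlane := by
    refine mem_slitPlane_of_norm_eq_one hw fun h => hne ?_
    rw [div_eq_iff hden] at h
    refine mul_left_cancel₀ ha ?_
    linear_combination h
  refine ⟨?_, ?_⟩
  · rw [hgt]
    simp only [neg_mul, Complex.neg_im, Complex.I_mul_im, Complex.log_re, hw, Real.log_one, neg_zero]
  · have hquot := (hder.add_const (a : ℂ)).div ((hder.const_mul (a : ℂ)).const_add 1)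
      (by rwa [hz])
    have hlog := (hquot.clog_real (by simpa [hz] using hslit)).const_mul (-Complex.I)
    refine hlog.congr_deriv ?_
    have hprod : (1 + a * z) * (z + a) = z * (a ^ 2 + 2 * a * Real.cos t + 1) := by
      linear_combination -a * hcos
    have hD : (a ^ 2 + 2 * a * Real.cos t + 1 : ℂ) = (1 + a * z) * (z + a) / z := by
      rw [hprod, mul_div_cancel_left₀ _ hz0]
    have hI : -Complex.I * Complex.I = 1 := by simp
    simp only [Pi.div_apply, hz]
    rw [Complex.ofReal_div]
    simp only [Complex.ofReal_add, Complex.ofReal_sub, Complex.ofReal_mul, Complex.ofReal_pow,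
      Complex.ofReal_one, Complex.ofReal_ofNat]
    rw [hD]
    calc _ = (-Complex.I * Complex.I) * ((1 - a ^ 2) / ((1 + a * z) * (z + a) / z)) := by
          field_simp
          ring
      _ = _ := by rw [hI, one_mul]
end

section
/- Let A ∈ ℝ and B > 0, and define δ = sign(A) · ( |A| − (√2/2) · √( A² − 1 − B² + √( −4A² + (1 + A² + B²)² ) ) ). Then |δ| < 1 and δ satisfies the quartic equation 2δ(2A − δ + 1)²(A − δ) + 4δB²(2A − δ) = 2(δ + 1)²(2A − δ)(A − δ). -/
open Real

/-- The square of the distance `u` between the splitting point and `A` is a root of a quadratic. -/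
lemma sq_offset_quadratic (a B u : ℝ)
    (hu : u = (√2 / 2) * √(a ^ 2 - 1 - B ^ 2 + √(-(4 * a ^ 2) + (1 + a ^ 2 + B ^ 2) ^ 2))) :
    u ^ 2 * (1 + u ^ 2 - a ^ 2) = B ^ 2 * (a ^ 2 - u ^ 2) := by
  have hD : -(4 * a ^ 2) + (1 + a ^ 2 + B ^ 2) ^ 2 =
      (a ^ 2 - 1 - B ^ 2) ^ 2 + (2 * a * B) ^ 2 := by ring
  rw [hD] at hu
  set P := a ^ 2 - 1 - B ^ 2 with hP
  have hR : √(P ^ 2 + (2 * a * B) ^ 2) ^ 2 = P ^ 2 + (2 * a * B) ^ 2 :=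
    Real.sq_sqrt (by positivity)
  have hPR : -P ≤ √(P ^ 2 + (2 * a * B) ^ 2) :=
    Real.le_sqrt_of_sq_le (by linarith [sq_nonneg (2 * a * B), neg_sq P])
  have hu2 : u ^ 2 = (P + √(P ^ 2 + (2 * a * B) ^ 2)) / 2 := by
    rw [hu, mul_pow, div_pow, Real.sq_sqrt (by norm_num), Real.sq_sqrt (by linarith)]
    ring
  have hR' : √(P ^ 2 + (2 * a * B) ^ 2) = 2 * u ^ 2 - P := by linarith
  rw [hR', hP] at hR
  linarith

lemma abs_sub_lt_one_of_quadratic {a B u : ℝ} (ha : 0 ≤ a) (hB : 0 < B) (hu : 0 ≤ u)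
    (h : u ^ 2 * (1 + u ^ 2 - a ^ 2) = B ^ 2 * (a ^ 2 - u ^ 2)) : |a - u| < 1 := by
  rw [abs_lt]
  constructor
  · by_contra! hle
    have hua : a ^ 2 < u ^ 2 := by nlinarith
    have hpos : 0 < B ^ 2 * (u ^ 2 - a ^ 2) := mul_pos (by positivity) (by linarith)
    have hnonneg : 0 ≤ u ^ 2 * (1 + u ^ 2 - a ^ 2) := mul_nonneg (by positivity) (by linarith)
    linarith
  · by_contra! hle
    have hua : u ^ 2 < a ^ 2 := by nlinarith
    have hpos : 0 < B ^ 2 * (a ^ 2 - u ^ 2) := mul_pos (by positivity) (by linarith)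
    have hnonpos : u ^ 2 * (1 + u ^ 2 - a ^ 2) ≤ 0 :=
      mul_nonpos_of_nonneg_of_nonpos (by positivity) (by nlinarith)
    linarith

/-- In terms of `u = A - δ` the quartic equation is quadratic in `u ^ 2`. -/
lemma quartic_of_quadratic {A B δ : ℝ}
    (h : (A - δ) ^ 2 * (1 + (A - δ) ^ 2 - A ^ 2) = B ^ 2 * (A ^ 2 - (A - δ) ^ 2)) :
    2 * δ * (2 * A - δ + 1) ^ 2 * (A - δ) + 4 * δ * B ^ 2 * (2 * A - δ) =
      2 * (δ + 1) ^ 2 * (2 * A - δ) * (A - δ) := by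
  linear_combination (-4) * h

/-- The optimal splitting point for Gauss–Legendre quadrature on `[−1,1]` with
singularities at `A ± Bi` satisfies `|δ| < 1` and the quartic equation
`2δ(2A − δ + 1)²(A − δ) + 4δB²(2A − δ) = 2(δ + 1)²(2A − δ)(A − δ)`. -/
theorem aperiodic_splitting_quartic
    (A : ℝ) (B : ℝ) (hB : 0 < B)
    (δ : ℝ)
    (hδ : δ = Real.sign A * (|A| - (Real.sqrt 2 / 2) *
      Real.sqrt (A ^ 2 - 1 - B ^ 2 +
        Real.sqrt (-(4 * A ^ 2) + (1 + A ^ 2 + B ^ 2) ^ 2)))) :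
    |δ| < 1 ∧
    2 * δ * (2 * A - δ + 1) ^ 2 * (A - δ) + 4 * δ * B ^ 2 * (2 * A - δ) =
      2 * (δ + 1) ^ 2 * (2 * A - δ) * (A - δ) := by
  set u := (√2 / 2) * √(A ^ 2 - 1 - B ^ 2 + √(-(4 * A ^ 2) + (1 + A ^ 2 + B ^ 2) ^ 2)) with hu
  have hq := sq_offset_quadratic A B u hu
  have hu0 : 0 ≤ u := by positivity
  have habs : |(|A| - u)| < 1 :=
    abs_sub_lt_one_of_quadratic (abs_nonneg A) hB hu0 (by rwa [sq_abs])
  clear_value u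
  rcases lt_trichotomy A 0 with hA | rfl | hA
  · rw [Real.sign_of_neg hA] at hδ
    refine ⟨by rwa [hδ, neg_one_mul, abs_neg], quartic_of_quadratic ?_⟩
    have : A - δ = -u := by rw [hδ, abs_of_neg hA]; ring
    rwa [this, neg_sq]
  · rw [Real.sign_zero, zero_mul] at hδ
    subst hδ
    norm_num
  · rw [Real.sign_of_pos hA] at hδ
    refine ⟨by rwa [hδ, one_mul], quartic_of_quadratic ?_⟩
    have : A - δ = u := by rw [hδ, abs_of_pos hA]; ring
    rwa [this]
end

section
/- Let A ∈ ℝ and B > 0. Set p = arsinh((1 − A)/B) and q = arsinh((1 + A)/B), and define x : ℝ → ℝ by x(t) = A + B·sinh( ((1 + t)/2)·p − ((1 − t)/2)·q ). Then x(−1) = −1, x(1) = 1, and for every real t, x is differentiable at t with x'(t) = ((p + q)/2) · √( (x(t) − A)² + B² ). -/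
open Real

/-- The hyperbolic sine transformation
`x(t) = A + B·sinh(((1+t)/2)·p − ((1−t)/2)·q)` with `p = arsinh((1−A)/B)` and
`q = arsinh((1+A)/B)` fixes `±1` and solves the differential equation
`x'(t) = ((p+q)/2)·√((x−A)² + B²)`. -/
theorem sinh_map_bvp
    (A B : ℝ) (hB : 0 < B)
    (p q : ℝ)
    (hp : p = Real.arsinh ((1 - A) / B))
    (hq : q = Real.arsinh ((1 + A) / B))
    (x : ℝ → ℝ)
    (hx : ∀ t : ℝ, x t = A + B * Real.sinh (((1 + t) / 2) * p - ((1 - t) / 2) * q)) :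
    x (-1) = -1 ∧ x 1 = 1 ∧
    ∀ t : ℝ, HasDerivAt x
      (((p + q) / 2) * Real.sqrt ((x t - A) ^ 2 + B ^ 2)) t := by
  refine ⟨?_, ?_, fun t => ?_⟩
  · have h : ((1 + (-1 : ℝ)) / 2) * p - ((1 - (-1)) / 2) * q = -q := by ring
    rw [hx, h, Real.sinh_neg, hq, Real.sinh_arsinh]
    field_simp
    ring
  · have h : ((1 + (1 : ℝ)) / 2) * p - ((1 - 1) / 2) * q = p := by ring
    rw [hx, h, hp, Real.sinh_arsinh]
    field_simp
    ring
  · set u : ℝ → ℝ := fun s => ((1 + s) / 2) * p - ((1 - s) / 2) * q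
    have hsqrt : Real.sqrt ((x t - A) ^ 2 + B ^ 2) = B * Real.cosh (u t) := by
      have h : (x t - A) ^ 2 + B ^ 2 = (B * Real.cosh (u t)) ^ 2 := by
        rw [mul_pow, Real.cosh_sq, hx]
        ring
      rw [h, Real.sqrt_sq (mul_nonneg hB.le (Real.cosh_pos _).le)]
    have hu' : HasDerivAt u ((p + q) / 2) t := by
      refine HasDerivAt.congr_deriv
        ((((hasDerivAt_id t).const_add 1).div_const 2 |>.mul_const p).sub
          (((hasDerivAt_id t).const_sub 1).div_const 2 |>.mul_const q)) ?_
      ring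
    have hx' : x = fun s => A + B * Real.sinh (u s) := funext hx
    rw [hsqrt, hx']
    exact ((hu'.sinh.const_mul B).const_add A).congr_deriv (by ring)
end

section
/- Let A ∈ ℝ and B > 0. Set p = arsinh((1 − A)/B) and q = arsinh((1 + A)/B); then p + q > 0. Define x : ℂ → ℂ by x(t) = A + B·sinh( ((1 + t)/2)·p − ((1 − t)/2)·q ) (complex hyperbolic sine), and let t* = 1 + (iπ − 2p)/(p + q). Then x(t*) = A + Bi. -/
open Real Complex

/-- The preimage of the singularity `A + Bi` under the complex-analytic
extension of the hyperbolic sine transformation is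
`t* = 1 + (iπ − 2p)/(p + q)`. -/
theorem sinh_map_singularity_preimage
    (A B : ℝ) (hB : 0 < B)
    (p q : ℝ)
    (hp : p = Real.arsinh ((1 - A) / B))
    (hq : q = Real.arsinh ((1 + A) / B))
    (x : ℂ → ℂ)
    (hx : ∀ t : ℂ, x t = A + B * Complex.sinh (((1 + t) / 2) * p - ((1 - t) / 2) * q))
    (tstar : ℂ)
    (htstar : tstar = 1 + (Complex.I * Real.pi - 2 * p) / (p + q)) :
    0 < p + q ∧ x tstar = A + B * Complex.I := by
  have hpos : 0 < p + q := by
    have h : Real.arsinh (-((1 + A) / B)) < Real.arsinh ((1 - A) / B) := by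
      rw [Real.arsinh_lt_arsinh, ← neg_div]
      exact div_lt_div_of_pos_right (by linarith) hB
    rw [Real.arsinh_neg, ← hp, ← hq] at h
    linarith
  refine ⟨hpos, ?_⟩
  have hne : (p : ℂ) + q ≠ 0 := by exact_mod_cast hpos.ne'
  have harg : ((1 + tstar) / 2) * p - ((1 - tstar) / 2) * q = (Real.pi / 2 : ℂ) * Complex.I := by
    rw [htstar]
    field_simp
    ring
  rw [hx, harg, Complex.sinh_mul_I, Complex.sin_pi_div_two, one_mul]
end

section
/- Let A ∈ ℝ and B > 0. Set P = arsinh( (2/π)·arsinh((1 − A)/B) ) and Q = arsinh( (2/π)·arsinh((1 + A)/B) ); then P + Q > 0. Define ℓ(t) = ((t + 1)/2)·P + ((t − 1)/2)·Q and x : ℂ → ℂ by x(t) = A + B·sinh( (π/2)·sinh(ℓ(t)) ) (complex hyperbolic sine). Then x(1) = 1, x(−1) = −1, and for t* = 1 + (iπ − 2P)/(P + Q) one has x(t*) = A + Bi. -/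
open Real Complex

/-- The iterated (double) sinh transformation
`x(t) = A + B·sinh((π/2)·sinh(ℓ(t)))` with
`ℓ(t) = ((t+1)/2)·P + ((t−1)/2)·Q`, `P = arsinh((2/π)·arsinh((1−A)/B))`,
`Q = arsinh((2/π)·arsinh((1+A)/B))`, fixes `±1` and sends
`t* = 1 + (iπ − 2P)/(P + Q)` to the singularity `A + Bi`. -/
theorem iterated_sinh_map_singularity_preimage
    (A B : ℝ) (hB : 0 < B)
    (P Q : ℝ)
    (hP : P = Real.arsinh ((2 / Real.pi) * Real.arsinh ((1 - A) / B)))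
    (hQ : Q = Real.arsinh ((2 / Real.pi) * Real.arsinh ((1 + A) / B)))
    (ℓ : ℂ → ℂ)
    (hℓ : ∀ t : ℂ, ℓ t = ((t + 1) / 2) * P + ((t - 1) / 2) * Q)
    (x : ℂ → ℂ)
    (hx : ∀ t : ℂ, x t = A + B * Complex.sinh ((Real.pi / 2) * Complex.sinh (ℓ t)))
    (tstar : ℂ)
    (htstar : tstar = 1 + (Complex.I * Real.pi - 2 * P) / (P + Q)) :
    0 < P + Q ∧ x 1 = 1 ∧ x (-1) = -1 ∧ x tstar = A + B * Complex.I := by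
  have hπ : (Real.pi : ℂ) ≠ 0 := by exact_mod_cast Real.pi_ne_zero
  have hBC : (B : ℂ) ≠ 0 := by exact_mod_cast hB.ne'
  have hpos : 0 < P + Q := by
    have h : -Q < P := by
      rw [hP, hQ, ← Real.arsinh_neg, Real.arsinh_lt_arsinh, ← mul_neg, ← Real.arsinh_neg]
      refine mul_lt_mul_of_pos_left ?_ (by positivity)
      rw [Real.arsinh_lt_arsinh, ← neg_div]
      exact div_lt_div_of_pos_right (by linarith) hB
    linarith
  have hPQ : (P : ℂ) + Q ≠ 0 := by exact_mod_cast hpos.ne'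
  have sinh_sinh (y : ℝ) :
      Complex.sinh ((Real.pi / 2) *
        Complex.sinh (Real.arsinh ((2 / Real.pi) * Real.arsinh y) : ℝ)) = y := by
    rw [← Complex.ofReal_sinh, Real.sinh_arsinh]
    have h : (Real.pi / 2 : ℂ) * ((2 / Real.pi * Real.arsinh y : ℝ) : ℂ) =
        (Real.arsinh y : ℝ) := by
      push_cast
      field_simp
    rw [h, ← Complex.ofReal_sinh, Real.sinh_arsinh]
  have sinh_I : Complex.sinh (Real.pi / 2 * Complex.I) = Complex.I := by
    rw [Complex.sinh_mul_I, Complex.sin_pi_div_two, one_mul]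
  refine ⟨hpos, ?_, ?_, ?_⟩
  · have h : ℓ 1 = P := by rw [hℓ]; ring
    rw [hx, h, hP, sinh_sinh]
    push_cast
    field_simp
    ring
  · have h : ℓ (-1) = -Q := by rw [hℓ]; ring
    rw [hx, h, Complex.sinh_neg, mul_neg, Complex.sinh_neg, hQ, sinh_sinh]
    push_cast
    field_simp
    ring
  · have h : ℓ tstar = Real.pi / 2 * Complex.I := by
      rw [hℓ, htstar]
      field_simp
      ring
    rw [hx, h, sinh_I, sinh_I]
end

section
/- Let A > 1, L = log((A + 1)/(A − 1)), and x : ℂ → ℂ given by x(t) = A + (1 − A)·exp( ((1 − t)/2)·L ). Then for every t ∈ ℂ with |Im t| < 2π/L, the value x(t) does not lie on the ray [A, ∞); that is, there is no real r with r ≥ A and x(t) = r. -/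
open Real Complex

/-- The exponential does not take nonpositive real values on the strip `|Im w| < π`. -/
lemma exp_ne_ofReal_of_nonpos {w : ℂ} (hw : |w.im| < Real.pi) {c : ℝ} (hc : c ≤ 0) :
    Complex.exp w ≠ c := by
  intro h
  obtain ⟨hl, hu⟩ := abs_lt.mp hw
  rcases hc.lt_or_eq with hc | rfl
  · have him : (Complex.log (Complex.exp w)).im = Real.pi := by
      rw [h, Complex.log_im, Complex.arg_ofReal_of_neg hc]
    rw [Complex.log_exp hl hu.le] at him
    exact hu.ne him
  · exact Complex.exp_ne_zero w (h.trans Complex.ofReal_zero)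

/-- On the horizontal strip `|Im t| < 2π/L`, the exponential transformation
`x(t) = A + (1 − A)·exp(((1 − t)/2)·L)`, `L = log((A+1)/(A−1))`, avoids the
branch cut `[A, ∞)`. -/
theorem exponential_map_avoids_branch_cut
    (A : ℝ) (hA : 1 < A)
    (L : ℝ) (hL : L = Real.log ((A + 1) / (A - 1)))
    (x : ℂ → ℂ)
    (hx : ∀ t : ℂ, x t = A + (1 - A) * Complex.exp (((1 - t) / 2) * L)) :
    ∀ t : ℂ, |t.im| < 2 * Real.pi / L →
      ¬ ∃ r : ℝ, A ≤ r ∧ x t = (r : ℂ) := by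
  rintro t ht ⟨r, hr, hxr⟩
  have hLpos : 0 < L := by
    rw [hL]
    apply Real.log_pos
    rw [one_lt_div (by linarith)]
    linarith
  rw [lt_div_iff₀ hLpos] at ht
  have him : (((1 - t) / 2) * (L : ℂ)).im = -(t.im * L / 2) := by
    simp [Complex.mul_im]
    ring
  have hstrip : |(((1 - t) / 2) * (L : ℂ)).im| < Real.pi := by
    rw [him, abs_neg, abs_div, abs_mul, abs_of_pos hLpos, abs_two]
    linarith
  have hc : (r - A) / (1 - A) ≤ 0 :=
    div_nonpos_of_nonneg_of_nonpos (by linarith) (by linarith)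
  apply exp_ne_ofReal_of_nonpos hstrip hc
  have hA' : (1 - A : ℂ) ≠ 0 := by
    exact_mod_cast (by linarith : 1 - A < 0).ne
  rw [hx] at hxr
  push_cast
  rw [eq_div_iff hA', ← hxr]
  ring
end

section
/- Let V be a real inner product space, let N, B ∈ V be orthonormal (‖N‖ = ‖B‖ = 1 and ⟨N, B⟩ = 0), let v ∈ V, and let ε > 0. Set M = √(⟨v, N⟩² + ⟨v, B⟩²) and suppose M > 0 and ‖v‖² + ε² ≥ 2εM. Then: (i) for every real t, ‖v − ε·cos(t)·N − ε·sin(t)·B‖² = ‖v‖² + ε² − 2ε(⟨v, N⟩·cos(t) + ⟨v, B⟩·sin(t)); and (ii) there exist ξ ∈ ℝ and c ≥ 0 with ⟨v, N⟩ = M·cos(ξ), ⟨v, B⟩ = M·sin(ξ), and cosh(c) = (‖v‖² + ε²)/(2εM), such that the complex function q(t) = ‖v‖² + ε² − 2ε(⟨v, N⟩·cos(t) + ⟨v, B⟩·sin(t)) (complex cosine and sine) vanishes at t* = ξ + i·c. -/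
open Real Complex RealInnerProductSpace

/-- The real Cartesian coordinates `(a, b)` written in polar form. -/
theorem exists_polar_coords (a b : ℝ) :
    ∃ ξ : ℝ, a = Real.sqrt (a ^ 2 + b ^ 2) * Real.cos ξ ∧
      b = Real.sqrt (a ^ 2 + b ^ 2) * Real.sin ξ := by
  have h : ‖(⟨a, b⟩ : ℂ)‖ = Real.sqrt (a ^ 2 + b ^ 2) := by
    rw [Complex.norm_eq_sqrt_sq_add_sq]
  refine ⟨Complex.arg ⟨a, b⟩, ?_, ?_⟩
  · rw [← h, Complex.norm_mul_cos_arg]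
  · rw [← h, Complex.norm_mul_sin_arg]

/-- Expansion of the squared distance from `v` to a point `a • N + b • B` of the plane spanned
by an orthonormal pair. -/
theorem norm_sub_smul_sub_smul_sq {V : Type*} [NormedAddCommGroup V] [InnerProductSpace ℝ V]
    {N B : V} (hN : ‖N‖ = 1) (hB : ‖B‖ = 1) (hNB : ⟪N, B⟫ = 0) (v : V) (a b : ℝ) :
    ‖v - a • N - b • B‖ ^ 2 =
      ‖v‖ ^ 2 + (a ^ 2 + b ^ 2) - 2 * (⟪v, N⟫ * a + ⟪v, B⟫ * b) := by
  rw [norm_sub_sq_real, norm_sub_sq_real, inner_sub_left]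
  simp only [real_inner_smul_left, real_inner_smul_right, norm_smul, hN, hB, hNB, mul_pow,
    Real.norm_eq_abs, sq_abs]
  ring

/-- A sinusoid with phase `ξ`, evaluated at `ξ + i c`, is a hyperbolic cosine. -/
theorem cos_mul_cos_add_sin_mul_sin_add_I_mul (ξ c : ℂ) :
    Complex.cos ξ * Complex.cos (ξ + Complex.I * c) +
      Complex.sin ξ * Complex.sin (ξ + Complex.I * c) = Complex.cosh c := by
  rw [add_comm ξ, mul_comm (Complex.cos ξ), mul_comm (Complex.sin ξ), ← Complex.cos_sub,
    add_sub_cancel_right, mul_comm, Complex.cos_mul_I]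

/-- The squared distance from a target point to the circular cross section of
a slender fiber is a shifted cosine in the angular variable `t`, and its
analytic continuation vanishes at the complex point
`t* = ξ + i·arccosh((‖v‖² + ε²)/(2εM))`. -/
theorem fiber_cross_section_singularity
    {V : Type*} [NormedAddCommGroup V] [InnerProductSpace ℝ V]
    (N B v : V) (hN : ‖N‖ = 1) (hB : ‖B‖ = 1) (hNB : ⟪N, B⟫ = 0)
    (ε : ℝ) (hε : 0 < ε)
    (M : ℝ) (hMdef : M = Real.sqrt (⟪v, N⟫ ^ 2 + ⟪v, B⟫ ^ 2))
    (hM : 0 < M)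
    (hgeom : 2 * ε * M ≤ ‖v‖ ^ 2 + ε ^ 2) :
    (∀ t : ℝ,
      ‖v - (ε * Real.cos t) • N - (ε * Real.sin t) • B‖ ^ 2 =
        ‖v‖ ^ 2 + ε ^ 2 -
          2 * ε * (⟪v, N⟫ * Real.cos t + ⟪v, B⟫ * Real.sin t)) ∧
    ∃ ξ c : ℝ, 0 ≤ c ∧
      ⟪v, N⟫ = M * Real.cos ξ ∧
      ⟪v, B⟫ = M * Real.sin ξ ∧
      Real.cosh c = (‖v‖ ^ 2 + ε ^ 2) / (2 * ε * M) ∧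
      ((‖v‖ ^ 2 + ε ^ 2 : ℝ) : ℂ) -
        2 * (ε : ℂ) * ((⟪v, N⟫ : ℝ) * Complex.cos (ξ + Complex.I * c) +
          (⟪v, B⟫ : ℝ) * Complex.sin (ξ + Complex.I * c)) = 0 := by
  constructor
  · intro t
    rw [norm_sub_smul_sub_smul_sq hN hB hNB]
    linear_combination ε ^ 2 * Real.sin_sq_add_cos_sq t
  · obtain ⟨ξ, hξN, hξB⟩ := exists_polar_coords ⟪v, N⟫ ⟪v, B⟫
    rw [← hMdef] at hξN hξB
    have hpos : 0 < 2 * ε * M := by positivity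
    have hone : 1 ≤ (‖v‖ ^ 2 + ε ^ 2) / (2 * ε * M) := (one_le_div hpos).2 hgeom
    have hcosh := Real.cosh_arcosh hone
    refine ⟨ξ, Real.arcosh ((‖v‖ ^ 2 + ε ^ 2) / (2 * ε * M)), Real.arcosh_nonneg hone,
      hξN, hξB, hcosh, ?_⟩
    generalize Real.arcosh ((‖v‖ ^ 2 + ε ^ 2) / (2 * ε * M)) = c at hcosh ⊢
    have hdist : ‖v‖ ^ 2 + ε ^ 2 = 2 * ε * M * Real.cosh c := by
      rw [hcosh, mul_div_cancel₀ _ hpos.ne']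
    rw [hdist, hξN, hξB]
    push_cast
    linear_combination (-2 * ε * M : ℂ) * cos_mul_cos_add_sin_mul_sin_add_I_mul ξ c
end
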